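/- For the randomly oriented Manhattan lattice drift field in dimension d, the H₋₁-condition ∫_{[-π,π]^d} ĝ(p) Σ_k Ĉ_{kk}(p) dp < ∞ (with ĝ(p) = (Σ_j (1-cos p_j))^{-1} and Ĉ the Fourier transform of the drift correlations) holds if and only if d ≥ 4. -/

import Mathlib

open MeasureTheory Filter Topology Classical

namespace ManhattanAux

/-- Projection of `ℝ^d` onto the unit torus. -/
noncomputable def proj (d : ℕ) (p : Fin d → ℝ) : UnitAddTorus (Fin d) :=
  fun i => ((p i / (2 * Real.pi) : ℝ) : UnitAddCircle)

lemma continuous_proj (d : ℕ) : Continuous (proj d) := by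
  unfold proj
  refine continuous_pi fun i => ?_
  exact (AddCircle.continuous_mk' 1).comp (by fun_prop)

/-- Integration against a finite measure as a continuous functional. -/
noncomputable def intL {X : Type*} [TopologicalSpace X] [CompactSpace X] [MeasurableSpace X]
    [BorelSpace X] (μ : Measure X) [IsFiniteMeasure μ] : C(X, ℂ) →L[ℂ] ℂ :=
  LinearMap.mkContinuous
    { toFun := fun F => ∫ x, F x ∂μ
      map_add' := fun F G => by
        have h (H : C(X, ℂ)) : Integrable (fun x => H x) μ :=
          (BoundedContinuousFunction.mkOfCompact H).integrable μ
        simpa using integral_add (h F) (h G)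
      map_smul' := fun c F => by
        simpa using integral_const_mul c (fun x => F x) }
    (μ.real Set.univ) (fun F => by
      have := norm_integral_le_of_norm_le_const (μ := μ) (f := fun x => F x) (C := ‖F‖)
        (Eventually.of_forall fun x => F.norm_coe_le_norm x)
      simpa [mul_comm] using this)

lemma integral_eq_of_mFourier {d : ℕ} (μ ν : Measure (UnitAddTorus (Fin d)))
    [IsFiniteMeasure μ] [IsFiniteMeasure ν]
    (h : ∀ n, ∫ x, UnitAddTorus.mFourier n x ∂μ = ∫ x, UnitAddTorus.mFourier n x ∂ν)
    (F : C(UnitAddTorus (Fin d), ℂ)) : ∫ x, F x ∂μ = ∫ x, F x ∂ν := by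
  have key : intL μ = intL ν := by
    refine ContinuousLinearMap.ext_on (s := Set.range (UnitAddTorus.mFourier (d := Fin d))) ?_ ?_
    · have := UnitAddTorus.span_mFourier_closure_eq_top (d := Fin d)
      exact (Submodule.dense_iff_topologicalClosure_eq_top).2 this
    · rintro _ ⟨n, rfl⟩
      exact h n
  exact congrArg (fun L => L F) key

/-- The reference measure: Dirac in coordinate `j`, Haar in the others. -/
noncomputable def fac {d : ℕ} (j i : Fin d) : Measure UnitAddCircle :=
  if i = j then Measure.dirac 0 else AddCircle.haarAddCircle

instance {d : ℕ} (j i : Fin d) : IsProbabilityMeasure (fac j i) := by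
  unfold fac; split_ifs <;> infer_instance

lemma integral_fourier_haar (n : ℤ) :
    ∫ x : UnitAddCircle, fourier n x ∂AddCircle.haarAddCircle = if n = 0 then 1 else 0 := by
  have := congrFun (fourierCoeff_fourier (T := 1) n) 0
  simp only [fourierCoeff, neg_zero, fourier_zero, one_smul] at this
  rw [this, Pi.single_apply]
  simp [eq_comm]

lemma mFourier_proj {d : ℕ} (n : Fin d → ℤ) (p : Fin d → ℝ) :
    UnitAddTorus.mFourier n (proj d p) =
      ((Real.cos (∑ i, (n i : ℝ) * p i) : ℝ) : ℂ)
        + ((Real.sin (∑ i, (n i : ℝ) * p i) : ℝ) : ℂ) * Complex.I := by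
  rw [Complex.ofReal_cos, Complex.ofReal_sin, ← Complex.exp_mul_I]
  simp only [UnitAddTorus.mFourier, ContinuousMap.coe_mk, proj]
  simp only [fourier_coe_apply, ← Complex.exp_sum]
  congr 1
  push_cast
  rw [Finset.sum_mul]
  refine Finset.sum_congr rfl fun i _ => ?_
  have : (Real.pi : ℂ) ≠ 0 := by exact_mod_cast Real.pi_ne_zero
  field_simp

/-- One-dimensional heat kernel factor. -/
noncomputable def aT (t : ℝ) : ℝ :=
  ∫ θ in Set.Ioc (-(1/2) : ℝ) (-(1/2) + 1), Real.exp (-(t * (1 - Real.cos (2 * Real.pi * θ))))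

/-- The torus version of the factor. -/
noncomputable def fT (t : ℝ) (q : UnitAddCircle) : ℝ :=
  Real.exp (-(t * (1 - (fourier 1 q : ℂ).re)))

lemma fT_coe (t x : ℝ) : fT t (x : UnitAddCircle) =
    Real.exp (-(t * (1 - Real.cos (2 * Real.pi * x)))) := by
  unfold fT
  rw [fourier_coe_apply]
  have : (2 * (Real.pi:ℂ) * Complex.I * ((1:ℤ):ℂ) * x / ((1:ℝ):ℂ)) =
    ((2 * Real.pi * x : ℝ) : ℂ) * Complex.I := by push_cast; ring
  rw [this, Complex.exp_ofReal_mul_I_re]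

lemma integral_fT_haar (t : ℝ) :
    ∫ q, ((fT t q : ℝ) : ℂ) ∂AddCircle.haarAddCircle = ((aT t : ℝ) : ℂ) := by
  rw [AddCircle.integral_haarAddCircle, integral_complex_ofReal, inv_one, one_smul]
  congr 1
  rw [← UnitAddCircle.integral_preimage (-(1/2))]
  simp only [fT_coe, aT]

lemma integral_heat {d : ℕ} (j : Fin d) (μ : Measure (Fin d → ℝ)) [IsFiniteMeasure μ]
    (hcos : ∀ (x : Fin d → ℤ),
      ∫ p, Real.cos (∑ i, (x i : ℝ) * p i) ∂μ
        = (2 * Real.pi) ^ d *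
            (if ∃ n : ℤ, ∀ i, x i = (if i = j then n else 0) then 1 else 0))
    (hsin : ∀ (x : Fin d → ℤ), ∫ p, Real.sin (∑ i, (x i : ℝ) * p i) ∂μ = 0) (t : ℝ) :
    ∫ p, Real.exp (-(t * ∑ i, (1 - Real.cos (p i)))) ∂μ
      = (2 * Real.pi) ^ d * aT t ^ (d - 1) := by
  have hmeas := (continuous_proj d).measurable
  set ν : Measure (UnitAddTorus (Fin d)) :=
    (ENNReal.ofReal ((2 * Real.pi) ^ d)) • Measure.pi (fac j) with hν
  have hpos : (0:ℝ) ≤ (2 * Real.pi) ^ d := by positivity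
  have : IsFiniteMeasure ν := by
    rw [hν]; exact Measure.smul_finite _ ENNReal.ofReal_ne_top
  have hprod : ∀ g : Fin d → UnitAddCircle → ℂ, ∫ x, ∏ i, g i (x i) ∂ν
      = (2 * Real.pi) ^ d * ∏ i, (if i = j then g i 0 else
          ∫ q, g i q ∂AddCircle.haarAddCircle) := by
    intro g
    rw [hν, integral_smul_measure, integral_fintype_prod_eq_prod, ENNReal.toReal_ofReal hpos,
      Complex.real_smul]
    push_cast
    congr 1
    refine Finset.prod_congr rfl fun i _ => ?_
    unfold fac
    split_ifs with h
    · exact integral_dirac _ _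
    · rfl
  have hF := integral_eq_of_mFourier (μ.map (proj d)) ν ?_
    ⟨fun q => ∏ i, ((fT t (q i) : ℝ) : ℂ), by unfold fT; fun_prop⟩
  · simp only [ContinuousMap.coe_mk] at hF
    rw [hprod (fun _ q => ((fT t q : ℝ) : ℂ)), integral_map hmeas.aemeasurable] at hF
    · have h1 : ∀ p : Fin d → ℝ, ∏ i, ((fT t (proj d p i) : ℝ) : ℂ)
          = ((Real.exp (-(t * ∑ i, (1 - Real.cos (p i)))) : ℝ) : ℂ) := by
        intro p
        rw [← Complex.ofReal_prod]
        congr 1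
        simp only [proj, fT_coe]
        rw [← Real.exp_sum]
        congr 1
        rw [Finset.sum_neg_distrib, ← Finset.mul_sum]
        congr 2
        refine Finset.sum_congr rfl fun i _ => ?_
        congr 2
        field_simp
      have h0 : fT t 0 = 1 := by
        have := fT_coe t 0
        simpa using this
      simp only [h1, integral_fT_haar, h0] at hF
      rw [integral_complex_ofReal] at hF
      rw [Finset.prod_ite] at hF
      have hc : (Finset.univ.filter (fun i : Fin d => ¬ i = j)).card = d - 1 := by
        rw [Finset.filter_ne' Finset.univ j, Finset.card_erase_of_mem (Finset.mem_univ _)]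
        simp
      simp only [Finset.prod_const, hc] at hF
      simp only [Complex.ofReal_one, one_pow, one_mul] at hF
      exact_mod_cast hF
    · refine Continuous.aestronglyMeasurable ?_
      unfold fT
      fun_prop
  · intro n
    rw [integral_map hmeas.aemeasurable
      (UnitAddTorus.mFourier n).continuous.aestronglyMeasurable]
    simp only [mFourier_proj]
    have hi : ∀ f : (Fin d → ℝ) → ℝ, Continuous f → (∀ p, ‖f p‖ ≤ 1) → Integrable f μ :=
      fun f hf hb => Integrable.of_bound hf.aestronglyMeasurable 1 (Eventually.of_forall hb)
    rw [integral_add, integral_mul_const, integral_complex_ofReal, integral_complex_ofReal,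
      hcos, hsin]
    · have := hprod (fun i q => fourier (n i) q)
      simp only [UnitAddTorus.mFourier, ContinuousMap.coe_mk]
      rw [this]
      push_cast
      rw [zero_mul, add_zero]
      congr 1
      simp only [fourier_eval_zero, integral_fourier_haar]
      split_ifs with h
      · obtain ⟨m, hm⟩ := h
        symm
        push_cast
        refine Finset.prod_eq_one fun i _ => ?_
        split_ifs with h1 h2
        · rfl
        · rfl
        · exact absurd (by rw [hm i, if_neg h1]) h2
      · symm
        push_cast
        by_contra hne
        rw [← ne_eq, Finset.prod_ne_zero_iff] at hne
        refine h ⟨n j, fun i => ?_⟩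
        have := hne i (Finset.mem_univ _)
        split_ifs with h1
        · rw [h1]
        · rw [if_neg h1] at this
          by_contra h2
          exact this (if_neg h2)
    · exact (hi _ (by fun_prop) (fun p => Real.abs_cos_le_one _)).ofReal
    · exact (hi _ (by fun_prop) (fun p => Real.abs_sin_le_one _)).ofReal.mul_const _

lemma lintegral_heat {d : ℕ} (j : Fin d) (μ : Measure (Fin d → ℝ)) [IsFiniteMeasure μ]
    (hcos : ∀ (x : Fin d → ℤ),
      ∫ p, Real.cos (∑ i, (x i : ℝ) * p i) ∂μ
        = (2 * Real.pi) ^ d *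
            (if ∃ n : ℤ, ∀ i, x i = (if i = j then n else 0) then 1 else 0))
    (hsin : ∀ (x : Fin d → ℤ), ∫ p, Real.sin (∑ i, (x i : ℝ) * p i) ∂μ = 0)
    (t : ℝ) (ht : 0 ≤ t) :
    ∫⁻ p, ENNReal.ofReal (Real.exp (-(t * ∑ i, (1 - Real.cos (p i))))) ∂μ
      = ENNReal.ofReal ((2 * Real.pi) ^ d) * ENNReal.ofReal (aT t ^ (d - 1)) := by
  rw [← ENNReal.ofReal_mul (by positivity), ← integral_heat j μ hcos hsin,
    ofReal_integral_eq_lintegral_ofReal]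
  · refine Integrable.of_bound (C := 1) (Continuous.aestronglyMeasurable (by fun_prop))
      (Eventually.of_forall fun p => ?_)
    rw [Real.norm_eq_abs, Real.abs_exp, Real.exp_le_one_iff, neg_nonpos]
    exact mul_nonneg ht (Finset.sum_nonneg fun i _ => by linarith [Real.cos_le_one (p i)])
  · exact Eventually.of_forall fun p => (Real.exp_pos _).le

lemma lintegral_exp (s : ℝ) (hs : 0 ≤ s) :
    ∫⁻ t in Set.Ioi (0:ℝ), ENNReal.ofReal (Real.exp (-(t * s))) = (ENNReal.ofReal s)⁻¹ := by
  rcases hs.eq_or_lt with rfl | hs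
  · simp
  · have h1 := integrableOn_exp_mul_Ioi (neg_lt_zero.2 hs) 0
    have h2 := integral_exp_mul_Ioi (neg_lt_zero.2 hs) 0
    have e : ∀ t : ℝ, -(t * s) = -s * t := fun t => by ring
    simp only [e]
    rw [← ofReal_integral_eq_lintegral_ofReal h1
      (Eventually.of_forall fun p => (Real.exp_pos _).le), h2, ← ENNReal.ofReal_inv_of_pos hs]
    simp

lemma lintegral_green {d : ℕ} (j : Fin d) (μ : Measure (Fin d → ℝ)) [IsFiniteMeasure μ]
    (hcos : ∀ (x : Fin d → ℤ),
      ∫ p, Real.cos (∑ i, (x i : ℝ) * p i) ∂μ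
        = (2 * Real.pi) ^ d *
            (if ∃ n : ℤ, ∀ i, x i = (if i = j then n else 0) then 1 else 0))
    (hsin : ∀ (x : Fin d → ℤ), ∫ p, Real.sin (∑ i, (x i : ℝ) * p i) ∂μ = 0) :
    ∫⁻ p, (∑ i : Fin d, ENNReal.ofReal (1 - Real.cos (p i)))⁻¹ ∂μ
      = ENNReal.ofReal ((2 * Real.pi) ^ d) *
        ∫⁻ t in Set.Ioi (0:ℝ), ENNReal.ofReal (aT t ^ (d - 1)) := by
  have hnn : ∀ x : ℝ, 0 ≤ 1 - Real.cos x := fun x => by linarith [Real.cos_le_one x]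
  calc _ = ∫⁻ p, (∫⁻ t in Set.Ioi (0:ℝ),
        ENNReal.ofReal (Real.exp (-(t * ∑ i, (1 - Real.cos (p i)))))) ∂μ := by
        refine lintegral_congr fun p => ?_
        rw [lintegral_exp _ (Finset.sum_nonneg fun i _ => hnn _),
          ENNReal.ofReal_sum_of_nonneg (fun i _ => hnn _)]
    _ = ∫⁻ t in Set.Ioi (0:ℝ), (∫⁻ p,
        ENNReal.ofReal (Real.exp (-(t * ∑ i, (1 - Real.cos (p i))))) ∂μ) := by
        refine lintegral_lintegral_swap (Measurable.aemeasurable ?_)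
        refine Continuous.measurable ?_
        simp only [Function.uncurry_def]
        exact ENNReal.continuous_ofReal.comp (by fun_prop)
    _ = ∫⁻ t in Set.Ioi (0:ℝ), ENNReal.ofReal ((2 * Real.pi) ^ d) *
          ENNReal.ofReal (aT t ^ (d - 1)) := by
        refine setLIntegral_congr_fun measurableSet_Ioi fun t ht => ?_
        exact lintegral_heat j μ hcos hsin t (le_of_lt ht)
    _ = _ := lintegral_const_mul' _ _ ENNReal.ofReal_ne_top

lemma integrable_aT (t : ℝ) : IntegrableOn
    (fun θ : ℝ => Real.exp (-(t * (1 - Real.cos (2 * Real.pi * θ)))))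
    (Set.Ioc (-(1/2) : ℝ) (-(1/2) + 1)) :=
  (Continuous.integrableOn_Icc (by fun_prop)).mono_set Set.Ioc_subset_Icc_self

lemma aT_nonneg (t : ℝ) : 0 ≤ aT t :=
  integral_nonneg fun _ => (Real.exp_pos _).le

lemma aT_le_one {t : ℝ} (ht : 0 ≤ t) : aT t ≤ 1 := by
  have : aT t ≤ ∫ θ in Set.Ioc (-(1/2) : ℝ) (-(1/2) + 1), (1:ℝ) := by
    refine integral_mono (integrable_aT t) (integrable_const _) fun θ => ?_
    simp only
    rw [Real.exp_le_one_iff, neg_nonpos]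
    exact mul_nonneg ht (by linarith [Real.cos_le_one (2 * Real.pi * θ)])
  simpa using this

lemma aT_upper {t : ℝ} (ht : 0 < t) : aT t ≤ t ^ (-(1/2) : ℝ) := by
  have hg := integrable_exp_neg_mul_sq (b := 8 * t) (by positivity)
  have h1 : aT t ≤ ∫ θ in Set.Ioc (-(1/2) : ℝ) (-(1/2) + 1), Real.exp (-(8 * t) * θ ^ 2) := by
    refine setIntegral_mono_on (integrable_aT t) hg.integrableOn measurableSet_Ioc fun θ hθ => ?_
    rw [Real.exp_le_exp]
    have hb : |2 * Real.pi * θ| ≤ Real.pi := by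
      rw [abs_mul, abs_of_pos (by positivity : 0 < 2 * Real.pi)]
      have : |θ| ≤ 1/2 := abs_le.2 ⟨by linarith [hθ.1], by linarith [hθ.2]⟩
      nlinarith [Real.pi_pos]
    have := Real.cos_le_one_sub_mul_cos_sq hb
    have e : 2 / Real.pi ^ 2 * (2 * Real.pi * θ) ^ 2 = 8 * θ ^ 2 := by field_simp; ring
    rw [e] at this
    nlinarith
  have h2 : ∫ θ in Set.Ioc (-(1/2) : ℝ) (-(1/2) + 1), Real.exp (-(8 * t) * θ ^ 2)
      ≤ ∫ θ, Real.exp (-(8 * t) * θ ^ 2) :=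
    setIntegral_le_integral hg (Eventually.of_forall fun _ => (Real.exp_pos _).le)
  rw [integral_gaussian] at h2
  refine h1.trans (h2.trans ?_)
  rw [Real.rpow_neg ht.le, ← Real.sqrt_eq_rpow, ← Real.sqrt_inv]
  refine Real.sqrt_le_sqrt ?_
  rw [div_le_iff₀ (by positivity)]
  have : t⁻¹ * (8 * t) = 8 := by field_simp
  rw [this]
  linarith [Real.pi_le_four]

lemma aT_lower {t : ℝ} (ht : 1 < t) : Real.exp (-5) * (√t)⁻¹ ≤ aT t := by
  have hs : 1 < √t := by rw [Real.lt_sqrt] <;> linarith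
  have hs2 : √t ^ 2 = t := Real.sq_sqrt (by linarith)
  set r := (√t)⁻¹ with hr
  have hr0 : 0 < r := by positivity
  have hr1 : r < 1 := inv_lt_one_of_one_lt₀ hs
  have hrt : t * r ^ 2 = 1 := by
    rw [hr, inv_pow, hs2]; exact mul_inv_cancel₀ (by linarith)
  have hsub : Set.Ioc (-(r/2)) (r/2) ⊆ Set.Ioc (-(1/2) : ℝ) (-(1/2) + 1) :=
    Set.Ioc_subset_Ioc (by linarith) (by linarith)
  have h1 : ∫ θ in Set.Ioc (-(r/2)) (r/2), Real.exp (-(t * (1 - Real.cos (2 * Real.pi * θ))))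
      ≤ aT t :=
    setIntegral_mono_set (integrable_aT t) (Eventually.of_forall fun _ => (Real.exp_pos _).le)
      hsub.eventuallyLE
  have h2 : ∫ θ in Set.Ioc (-(r/2)) (r/2), Real.exp (-5)
      ≤ ∫ θ in Set.Ioc (-(r/2)) (r/2), Real.exp (-(t * (1 - Real.cos (2 * Real.pi * θ)))) := by
    refine setIntegral_mono_on (integrable_const _) ((integrable_aT t).mono_set hsub)
      measurableSet_Ioc fun θ hθ => ?_
    rw [Real.exp_le_exp, neg_le_neg_iff]
    have hc := Real.one_sub_sq_div_two_le_cos (x := 2 * Real.pi * θ)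
    have hθ2 : θ ^ 2 ≤ (r/2) ^ 2 := sq_le_sq' (by linarith [hθ.1]) hθ.2
    have hpi : Real.pi ^ 2 ≤ 10 := by
      nlinarith [Real.pi_lt_d2, Real.pi_pos]
    have h3 : 1 - Real.cos (2 * Real.pi * θ) ≤ 20 * θ ^ 2 := by
      nlinarith [sq_nonneg θ]
    calc t * (1 - Real.cos (2 * Real.pi * θ)) ≤ t * (20 * (r/2) ^ 2) := by
          refine mul_le_mul_of_nonneg_left (by linarith) (by linarith)
      _ = 5 * (t * r ^ 2) := by ring
      _ = 5 := by rw [hrt]; norm_num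
  refine le_trans (le_of_eq ?_) (h2.trans h1)
  rw [setIntegral_const, Measure.real, Real.volume_Ioc, ENNReal.toReal_ofReal (by linarith)]
  simp only [smul_eq_mul]; ring

lemma aT_finite {n : ℕ} (hn : 3 ≤ n) :
    ∫⁻ t in Set.Ioi (0:ℝ), ENNReal.ofReal (aT t ^ n) < ⊤ := by
  rw [← Set.Ioc_union_Ioi_eq_Ioi (zero_le_one' ℝ),
    lintegral_union measurableSet_Ioi (Set.Ioc_disjoint_Ioi le_rfl)]
  refine ENNReal.add_lt_top.2 ⟨?_, ?_⟩
  · calc _ ≤ ∫⁻ t in Set.Ioc (0:ℝ) 1, 1 := by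
          refine setLIntegral_mono measurable_const fun t ht => ?_
          rw [ENNReal.ofReal_le_one]
          exact pow_le_one₀ (aT_nonneg t) (aT_le_one ht.1.le)
      _ < ⊤ := by simp
  · have hi := integrableOn_Ioi_rpow_of_lt (a := -(3/2)) (by norm_num) (zero_lt_one' ℝ)
    refine lt_of_le_of_lt ?_ hi.lintegral_lt_top
    refine setLIntegral_mono (by fun_prop) fun t ht => ENNReal.ofReal_le_ofReal ?_
    have ht0 : (0:ℝ) < t := lt_trans one_pos ht
    calc aT t ^ n ≤ aT t ^ 3 := pow_le_pow_of_le_one (aT_nonneg t) (aT_le_one ht0.le) hn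
      _ ≤ (t ^ (-(1/2) : ℝ)) ^ 3 := pow_le_pow_left₀ (aT_nonneg t) (aT_upper ht0) 3
      _ = t ^ (-(3/2) : ℝ) := by
        rw [← Real.rpow_natCast, ← Real.rpow_mul ht0.le]; norm_num

lemma aT_infinite {n : ℕ} (hn : n ≤ 2) :
    ¬ ∫⁻ t in Set.Ioi (0:ℝ), ENNReal.ofReal (aT t ^ n) < ⊤ := by
  intro h
  refine not_integrableOn_Ioi_inv (a := 1) ?_
  refine ⟨by fun_prop, ?_⟩
  rw [hasFiniteIntegral_iff_ofReal]
  · have hb : ∫⁻ t in Set.Ioi (1:ℝ), ENNReal.ofReal (Real.exp (-10)) * ENNReal.ofReal t⁻¹ < ⊤ := by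
      refine lt_of_le_of_lt ?_ h
      refine le_trans ?_ (lintegral_mono_set (Set.Ioi_subset_Ioi (zero_le_one' ℝ)))
      refine setLIntegral_mono' measurableSet_Ioi fun t ht => ?_
      have ht0 : (0:ℝ) < t := lt_trans one_pos ht
      rw [← ENNReal.ofReal_mul (Real.exp_pos _).le]
      refine ENNReal.ofReal_le_ofReal ?_
      calc Real.exp (-10) * t⁻¹ = (Real.exp (-5) * (√t)⁻¹) ^ 2 := by
            rw [mul_pow, inv_pow, Real.sq_sqrt ht0.le, ← Real.exp_nat_mul]; norm_num
        _ ≤ aT t ^ 2 := pow_le_pow_left₀ (by positivity) (aT_lower ht) 2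
        _ ≤ aT t ^ n := pow_le_pow_of_le_one (aT_nonneg t) (aT_le_one ht0.le) hn
    rw [lintegral_const_mul' _ _ ENNReal.ofReal_ne_top] at hb
    refine ENNReal.lt_top_of_mul_ne_top_right hb.ne ?_
    simpa using Real.exp_pos _
  · refine (ae_restrict_iff' measurableSet_Ioi).2 (Eventually.of_forall fun t ht => ?_)
    exact inv_nonneg.2 (le_of_lt (lt_trans one_pos ht))

end ManhattanAux

/-- for the randomly oriented Manhattan lattice in dimension `d`, the
`H₋₁`-condition `∫_{[-π,π]^d} ĝ(p) ∑_k Ĉ_{kk}(p) dp < ∞` holds iff `d ≥ 4`.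

For this model `C_{k,k}(x) = 1` iff `x` lies on the line `ℤk` (and the two orientations
`±e_j` of a line give the same diagonal correlation), so the Fourier transform
`Ĉ_{kk}(p) dp` is the finite positive measure `μ j` on `[-π,π]^d` (the uniform measure on
the hyperplane `{p_j = 0}`, viewed inside `[-π,π]^d`) characterised by its
Fourier coefficients `∫ e^{i x·p} dμ_j(p) = (2π)^d C_{e_j,e_j}(x) = (2π)^d 1{x ∈ ℤe_j}`.
The Green kernel `ĝ(p) = (∑_i (1 - cos p_i))⁻¹` is taken with values in `ℝ≥0∞`
(so `ĝ = ∞` at `p ≡ 0`).  The `H₋₁`-condition reads `∑_j ∫ ĝ dμ_j < ∞`. -/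
theorem manhattan_H_minus_one_iff_dim_ge_four
    (d : ℕ) (hd : 1 ≤ d)
    (μ : Fin d → Measure (Fin d → ℝ))
    (hfin : ∀ j, IsFiniteMeasure (μ j))
    (hcos : ∀ (j : Fin d) (x : Fin d → ℤ),
      ∫ p, Real.cos (∑ i, (x i : ℝ) * p i) ∂(μ j)
        = (2 * Real.pi) ^ d *
            (if ∃ n : ℤ, ∀ i, x i = (if i = j then n else 0) then 1 else 0))
    (hsin : ∀ (j : Fin d) (x : Fin d → ℤ),
      ∫ p, Real.sin (∑ i, (x i : ℝ) * p i) ∂(μ j) = 0) :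
    (∑ j : Fin d,
        ∫⁻ p, (∑ i : Fin d, ENNReal.ofReal (1 - Real.cos (p i)))⁻¹ ∂(μ j)) < ⊤
      ↔ 4 ≤ d := by
  have hterm : ∀ j : Fin d,
      ∫⁻ p, (∑ i : Fin d, ENNReal.ofReal (1 - Real.cos (p i)))⁻¹ ∂(μ j)
        = ENNReal.ofReal ((2 * Real.pi) ^ d) *
          ∫⁻ t in Set.Ioi (0:ℝ), ENNReal.ofReal (ManhattanAux.aT t ^ (d - 1)) := fun j => by
    have := hfin j
    exact ManhattanAux.lintegral_green j (μ j) (hcos j) (hsin j)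
  simp only [hterm]
  rw [ENNReal.sum_lt_top]
  constructor
  · intro h
    by_contra hlt
    refine ManhattanAux.aT_infinite (n := d - 1) (by omega) ?_
    have hj := h ⟨0, hd⟩ (Finset.mem_univ _)
    refine ENNReal.lt_top_of_mul_ne_top_right hj.ne ?_
    have : (0:ℝ) < (2 * Real.pi) ^ d := by positivity
    simpa using this
  · intro h j _
    exact ENNReal.mul_lt_top ENNReal.ofReal_lt_top (ManhattanAux.aT_finite (by omega))
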